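/- Let E be a finite-dimensional complex vector space, let A be an invertible ℂ-linear endomorphism of E, and let δ ≥ 1 be an integer. For an entire function V : ℂ → E with Taylor expansion V(ξ) = Σ_{n≥0} V_n ξ^n and any endomorphism M of E, the series V(M) := Σ_{n≥0} M^n V_n converges absolutely in E. Then: (a) the operator W(ξ) ↦ ξ^δ W(ξ) − A^δ(W(ξ)) is injective on E-valued entire functions; (b) an entire V : ℂ → E can be written as V(ξ) = ξ^δ W(ξ) − A^δ(W(ξ)) for some entire W : ℂ → E if and only if V(jA) = 0 for every δ-th root of unity j ∈ μ_δ. -/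

import Mathlib

open Filter Topology in
lemma aux_unique {E : Type*} [NormedAddCommGroup E] [NormedSpace ℂ E] (V : ℂ → E) (a b : ℕ → E)
    (ha : ∀ ξ : ℂ, HasSum (fun n : ℕ => ξ ^ n • a n) (V ξ))
    (hb : ∀ ξ : ℂ, HasSum (fun n : ℕ => ξ ^ n • b n) (V ξ)) : a = b := by
  have key : ∀ c : ℕ → E, (∀ ξ : ℂ, HasSum (fun n : ℕ => ξ ^ n • c n) (V ξ)) →
      HasFPowerSeriesAt V (fun n => ContinuousMultilinearMap.mkPiRing ℂ (Fin n) (c n)) 0 := by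
    intro c hc
    refine hasFPowerSeriesAt_iff.2 ?_
    refine Eventually.of_forall fun z => ?_
    simpa [FormalMultilinearSeries.coeff] using hc z
  have h := (key a ha).eq_formalMultilinearSeries (key b hb)
  funext n
  have := congrFun h n
  simpa [FormalMultilinearSeries.coeff] using congrArg (fun p => p (fun _ => (1 : ℂ))) this

lemma aux_shift {E : Type*} [NormedAddCommGroup E] (F G : ℕ → E) (d : ℕ) (s : E)
    (h0 : ∀ n, n < d → F n = 0) (h1 : ∀ n, F (n + d) = G n) (hG : HasSum G s) : HasSum F s := by
  have h : HasSum (fun n => F (n + d)) s := by simpa [h1] using hG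
  have := (hasSum_nat_add_iff d).1 h
  rwa [Finset.sum_eq_zero (fun i hi => h0 i (Finset.mem_range.1 hi)), add_zero] at this

lemma aux_norm_summable {E : Type*} [NormedAddCommGroup E] [NormedSpace ℂ E]
    [FiniteDimensional ℂ E] (V : ℂ → E) (a : ℕ → E)
    (ha : ∀ ξ : ℂ, HasSum (fun n : ℕ => ξ ^ n • a n) (V ξ)) (R : ℝ) (hR : 0 ≤ R) :
    Summable (fun n => R ^ n * ‖a n‖) := by
  haveI : FiniteDimensional ℝ E := FiniteDimensional.complexToReal E
  have := summable_norm_iff.2 (ha (R : ℂ)).summable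
  simpa [norm_smul, abs_of_nonneg hR] using this

lemma aux_pow_le {E : Type*} [NormedAddCommGroup E] [NormedSpace ℂ E] (M : E →L[ℂ] E) (n : ℕ)
    (x : E) : ‖(M ^ n) x‖ ≤ ‖M‖ ^ n * ‖x‖ := by
  induction n generalizing x with
  | zero => simp
  | succ k ih =>
    rw [pow_succ, ContinuousLinearMap.mul_apply]
    calc ‖(M ^ k) (M x)‖ ≤ ‖M‖ ^ k * ‖M x‖ := ih _
      _ ≤ ‖M‖ ^ k * (‖M‖ * ‖x‖) := by gcongr; exact M.le_opNorm x
      _ = _ := by ring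

lemma aux_end_summable {E : Type*} [NormedAddCommGroup E] [NormedSpace ℂ E]
    [FiniteDimensional ℂ E] (M : E →L[ℂ] E) (V : ℂ → E) (a : ℕ → E)
    (ha : ∀ ξ : ℂ, HasSum (fun n : ℕ => ξ ^ n • a n) (V ξ)) :
    Summable (fun n : ℕ => ‖(M ^ n) (a n)‖) :=
  Summable.of_nonneg_of_le (fun _ => norm_nonneg _) (fun n => aux_pow_le M n (a n))
    (aux_norm_summable V a ha ‖M‖ (norm_nonneg _))

open Filter Topology in
lemma aux_inj {E : Type*} [NormedAddCommGroup E] [NormedSpace ℂ E] [CompleteSpace E]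
    (B : E →L[ℂ] E) (δ : ℕ) (hδ : 1 ≤ δ) (W₁ W₂ : ℂ → E) (h₁ : Differentiable ℂ W₁)
    (h₂ : Differentiable ℂ W₂)
    (h : ∀ ξ : ℂ, ξ ^ δ • W₁ ξ - B (W₁ ξ) = ξ ^ δ • W₂ ξ - B (W₂ ξ)) : W₁ = W₂ := by
  have key : ∀ ξ : ℂ, ‖B‖ < ‖ξ‖ ^ δ → W₁ ξ = W₂ ξ := by
    intro ξ hξ
    by_contra hne
    have hpos : 0 < ‖W₁ ξ - W₂ ξ‖ := norm_pos_iff.2 (sub_ne_zero.2 hne)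
    have e : ξ ^ δ • (W₁ ξ - W₂ ξ) = B (W₁ ξ - W₂ ξ) := by
      rw [smul_sub, map_sub]
      have := h ξ
      rw [sub_eq_sub_iff_add_eq_add] at this
      rw [sub_eq_sub_iff_add_eq_add, this, add_comm]
    have := B.le_opNorm (W₁ ξ - W₂ ξ)
    rw [← e, norm_smul, norm_pow] at this
    nlinarith
  have a₁ : AnalyticOnNhd ℂ W₁ Set.univ := fun z _ => h₁.analyticAt z
  have a₂ : AnalyticOnNhd ℂ W₂ Set.univ := fun z _ => h₂.analyticAt z
  refine a₁.eq_of_eventuallyEq (z₀ := ((‖B‖ + 1 : ℝ) : ℂ)) a₂ ?_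
  have ho : IsOpen {ξ : ℂ | ‖B‖ < ‖ξ‖ ^ δ} := isOpen_lt continuous_const (by fun_prop)
  refine Filter.eventually_of_mem (ho.mem_nhds ?_) key
  have hb := norm_nonneg B
  have : ‖((‖B‖ + 1 : ℝ) : ℂ)‖ = ‖B‖ + 1 := by
    rw [Complex.norm_real, Real.norm_of_nonneg (by linarith)]
  rw [Set.mem_setOf_eq, this]
  have := le_self_pow₀ (a := ‖B‖ + 1) (by linarith) (show δ ≠ 0 by omega)
  linarith

lemma aux_taylor {E : Type*} [NormedAddCommGroup E] [NormedSpace ℂ E] [CompleteSpace E]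
    (W : ℂ → E) (hW : Differentiable ℂ W) :
    ∃ a : ℕ → E, ∀ ξ : ℂ, HasSum (fun n : ℕ => ξ ^ n • a n) (W ξ) := by
  refine ⟨fun n => (n.factorial : ℂ)⁻¹ • iteratedDeriv n W 0, fun ξ => ?_⟩
  have := Complex.hasSum_taylorSeries_of_entire hW 0 ξ
  refine this.congr_fun fun n => ?_
  rw [sub_zero, smul_comm]

lemma aux_entire {E : Type*} [NormedAddCommGroup E] [NormedSpace ℂ E] [CompleteSpace E]
    (a : ℕ → E) (h : ∀ R : ℝ, 0 < R → ∃ C, ∀ n, R ^ n * ‖a n‖ ≤ C) :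
    Differentiable ℂ (fun ξ : ℂ => ∑' n : ℕ, ξ ^ n • a n) ∧
    ∀ ξ : ℂ, Summable (fun n : ℕ => ξ ^ n • a n) := by
  have key : ∀ R : ℝ, 0 < R → ∃ u : ℕ → ℝ, Summable u ∧
      ∀ n : ℕ, ∀ ξ ∈ Metric.ball (0 : ℂ) R, ‖ξ ^ n • a n‖ ≤ u n := by
    intro R hR
    obtain ⟨C, hC⟩ := h (2 * R) (by linarith)
    refine ⟨fun n => C * (1 / 2) ^ n,
      (summable_geometric_of_lt_one (by norm_num) (by norm_num)).mul_left C, ?_⟩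
    intro n ξ hξ
    have hξ' : ‖ξ‖ ≤ R := by simpa using (mem_ball_zero_iff.1 hξ).le
    rw [norm_smul, norm_pow]
    calc ‖ξ‖ ^ n * ‖a n‖ ≤ R ^ n * ‖a n‖ := by gcongr
      _ = ((2 * R) ^ n * ‖a n‖) * (1 / 2) ^ n := by
        rw [mul_pow, one_div, inv_pow]; field_simp
      _ ≤ C * (1 / 2) ^ n := by gcongr; exact hC n
  constructor
  · intro ξ
    obtain ⟨u, hu, hb⟩ := key (‖ξ‖ + 1) (by positivity)
    have := Complex.differentiableOn_tsum_of_summable_norm (F := fun n (ξ : ℂ) => ξ ^ n • a n)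
      hu (fun n => by fun_prop) Metric.isOpen_ball hb
    exact this.differentiableAt (Metric.isOpen_ball.mem_nhds (by simp))
  · intro ξ
    obtain ⟨u, hu, hb⟩ := key (‖ξ‖ + 1) (by positivity)
    exact Summable.of_norm_bounded hu (fun n => hb n ξ (by simp))

lemma aux_fwd {E : Type*} [NormedAddCommGroup E] [NormedSpace ℂ E] [FiniteDimensional ℂ E]
    (A : E →L[ℂ] E) (δ : ℕ) (V : ℂ → E) (Vc : ℕ → E)
    (hV : ∀ ξ : ℂ, HasSum (fun n : ℕ => ξ ^ n • Vc n) (V ξ)) (W : ℂ → E)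
    (hW : Differentiable ℂ W) (h : ∀ ξ : ℂ, V ξ = ξ ^ δ • W ξ - (A ^ δ) (W ξ))
    (j : ℂ) (hj : j ^ δ = 1) : (∑' n : ℕ, ((j • A) ^ n) (Vc n)) = 0 := by
  haveI : CompleteSpace E := FiniteDimensional.complete ℂ E
  obtain ⟨a, ha⟩ := aux_taylor W hW
  set b : ℕ → E := fun n => if n < δ then 0 else a (n - δ) with hb
  have hb0 : ∀ n, n < δ → b n = 0 := fun n hn => by simp [hb, hn]
  have hb1 : ∀ n, b (n + δ) = a n := fun n => by simp [hb]
  have hc : Vc = fun n => b n - (A ^ δ) (a n) := by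
    refine aux_unique V _ _ hV fun ξ => ?_
    rw [h ξ]
    have s1 : HasSum (fun n => ξ ^ n • b n) (ξ ^ δ • W ξ) := by
      refine aux_shift _ (fun n => ξ ^ δ • ξ ^ n • a n) δ _ (fun n hn => by simp [hb0 n hn])
        (fun n => ?_) ((ha ξ).const_smul _)
      rw [hb1, pow_add, mul_comm, mul_smul]
    have s2 := (A ^ δ).hasSum (ha ξ)
    refine (s1.sub s2).congr_fun fun n => ?_
    rw [smul_sub, map_smul]
  set M := j • A with hM
  have hMδ : M ^ δ = A ^ δ := by rw [hM, smul_pow, hj, one_smul]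
  have hs : Summable (fun n => (M ^ n) (a n)) := (aux_end_summable M W a ha).of_norm
  have s2 := (A ^ δ).hasSum hs.hasSum
  have s1 : HasSum (fun n => (M ^ n) (b n)) ((A ^ δ) (∑' n, (M ^ n) (a n))) := by
    refine aux_shift _ _ δ _ (fun n hn => by simp [hb0 n hn]) (fun n => ?_) s2
    rw [hb1, add_comm, pow_add, hMδ]; rfl
  have s3 := s1.sub s2
  rw [sub_self] at s3
  rw [← s3.tsum_eq]
  congr 1
  funext n
  rw [hc, map_sub, ← hMδ]
  have := DFunLike.congr_fun (pow_mul_comm M n δ) (a n)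
  simp only [ContinuousLinearMap.mul_apply] at this
  rw [this]

lemma aux_residue {E : Type*} [NormedAddCommGroup E] [NormedSpace ℂ E] [FiniteDimensional ℂ E]
    (A : E →L[ℂ] E) (d : ℕ) (V : ℂ → E) (Vc : ℕ → E)
    (hV : ∀ ξ : ℂ, HasSum (fun n : ℕ => ξ ^ n • Vc n) (V ξ))
    (h : ∀ j : ℂ, j ^ (d + 1) = 1 → (∑' n : ℕ, ((j • A) ^ n) (Vc n)) = 0) (r : Fin (d + 1)) :
    ∑' k : ℕ, (A ^ ((r : ℕ) + (d + 1) * k)) (Vc ((r : ℕ) + (d + 1) * k)) = 0 := by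
  haveI : CompleteSpace E := FiniteDimensional.complete ℂ E
  set S : Fin (d + 1) → E := fun r =>
    ∑' k : ℕ, (A ^ ((r : ℕ) + (d + 1) * k)) (Vc ((r : ℕ) + (d + 1) * k)) with hS
  have h1 : ∀ j : ℂ, j ^ (d + 1) = 1 → ∑ r : Fin (d + 1), j ^ (r : ℕ) • S r = 0 := by
    intro j hj
    rw [← h j hj]
    have hs : Summable (fun n => ((j • A) ^ n) (Vc n)) := (aux_end_summable _ V Vc hV).of_norm
    have := Nat.sumByResidueClasses hs (d + 1)
    rw [this]
    refine Finset.sum_congr rfl fun r _ => ?_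
    change _ = ∑' m : ℕ, ((j • A) ^ ((r : ℕ) + (d + 1) * m)) (Vc ((r : ℕ) + (d + 1) * m))
    rw [hS, ← tsum_const_smul'']
    congr 1
    funext k
    rw [smul_pow, pow_add j, pow_mul, hj, one_pow, mul_one]; rfl
  have hζ := Complex.isPrimitiveRoot_exp (d + 1) (by omega)
  set ζ := Complex.exp (2 * Real.pi * Complex.I / ((d + 1 : ℕ) : ℂ))
  change S r = 0
  refine NormedSpace.eq_zero_of_forall_dual_eq_zero ℂ fun f => ?_
  have hinj : Function.Injective (fun i : Fin (d + 1) => ζ ^ (i : ℕ)) := by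
    intro a b hab
    exact Fin.ext (hζ.pow_inj a.2 b.2 hab)
  have := Matrix.eq_zero_of_forall_index_sum_mul_pow_eq_zero (v := fun r => f (S r)) hinj ?_
  · exact congrFun this r
  · intro i
    have := congrArg f (h1 (ζ ^ (i : ℕ)) (by rw [← pow_mul, mul_comm, pow_mul, hζ.pow_eq_one, one_pow]))
    rw [map_sum, map_zero] at this
    rw [← this]
    refine Finset.sum_congr rfl fun r _ => ?_
    simp [mul_comm]

lemma aux_bwd {E : Type*} [NormedAddCommGroup E] [NormedSpace ℂ E] [FiniteDimensional ℂ E]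
    (A : E →L[ℂ] E) (hA : Function.Injective A) (d : ℕ) (V : ℂ → E) (Vc : ℕ → E)
    (hV : ∀ ξ : ℂ, HasSum (fun n : ℕ => ξ ^ n • Vc n) (V ξ))
    (h : ∀ j : ℂ, j ^ (d + 1) = 1 → (∑' n : ℕ, ((j • A) ^ n) (Vc n)) = 0) :
    ∃ W : ℂ → E, Differentiable ℂ W ∧
      ∀ ξ : ℂ, V ξ = ξ ^ (d + 1) • W ξ - (A ^ (d + 1)) (W ξ) := by
  haveI : CompleteSpace E := FiniteDimensional.complete ℂ E
  set δ := d + 1 with hδ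
  set B := A ^ δ with hB
  -- basic estimate
  have est : ∀ S : ℝ, 1 ≤ S → ‖A‖ ≤ S → ∀ n k : ℕ,
      S ^ n * ‖(B ^ k) (Vc (n + δ * k))‖ ≤ S ^ (n + δ * k) * ‖Vc (n + δ * k)‖ := by
    intro S hS hAS n k
    have := aux_pow_le A (δ * k) (Vc (n + δ * k))
    rw [pow_mul, ← hB] at this
    calc S ^ n * ‖(B ^ k) (Vc (n + δ * k))‖
        ≤ S ^ n * (‖A‖ ^ (δ * k) * ‖Vc (n + δ * k)‖) := by gcongr
      _ ≤ S ^ n * (S ^ (δ * k) * ‖Vc (n + δ * k)‖) := by gcongr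
      _ = _ := by rw [pow_add]; ring
  have inj : ∀ n : ℕ, Function.Injective (fun k : ℕ => n + δ * k) := by
    intro n a b hab
    have : δ * a = δ * b := by simpa using hab
    exact Nat.eq_of_mul_eq_mul_left (by omega) this
  have sm : ∀ S : ℝ, 1 ≤ S → ‖A‖ ≤ S → ∀ n : ℕ,
      Summable (fun k : ℕ => S ^ n * ‖(B ^ k) (Vc (n + δ * k))‖) := by
    intro S hS hAS n
    exact Summable.of_nonneg_of_le (fun k => by positivity) (est S hS hAS n)
      ((aux_norm_summable V Vc hV S (by linarith)).comp_injective (inj n))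
  set T : ℕ → E := fun n => ∑' k : ℕ, (B ^ k) (Vc (n + δ * k)) with hT
  have smB : ∀ n, Summable (fun k : ℕ => (B ^ k) (Vc (n + δ * k))) := by
    intro n
    have := sm (‖A‖ + 1) (by linarith [norm_nonneg A]) (by linarith) n
    refine Summable.of_norm ?_
    exact (summable_mul_left_iff (by positivity)).1 this
  have hTb : ∀ S : ℝ, 1 ≤ S → ‖A‖ ≤ S → ∀ n : ℕ,
      S ^ n * ‖T n‖ ≤ ∑' m, S ^ m * ‖Vc m‖ := by
    intro S hS hAS n
    have hsV := aux_norm_summable V Vc hV S (by linarith)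
    have h0 : Summable (fun k : ℕ => ‖(B ^ k) (Vc (n + δ * k))‖) :=
      (summable_mul_left_iff (by positivity)).1 (sm S hS hAS n)
    calc S ^ n * ‖T n‖ ≤ S ^ n * ∑' k : ℕ, ‖(B ^ k) (Vc (n + δ * k))‖ := by
          gcongr; exact norm_tsum_le_tsum_norm h0
      _ = ∑' k : ℕ, S ^ n * ‖(B ^ k) (Vc (n + δ * k))‖ := by rw [tsum_mul_left]
      _ ≤ ∑' k : ℕ, S ^ (n + δ * k) * ‖Vc (n + δ * k)‖ :=
          (sm S hS hAS n).tsum_le_tsum (est S hS hAS n) (hsV.comp_injective (inj n))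
      _ ≤ ∑' m, S ^ m * ‖Vc m‖ :=
          tsum_comp_le_tsum_of_inj hsV (fun m => by positivity) (inj n)
  have hrec : ∀ n, T n = Vc n + B (T (n + δ)) := by
    intro n
    simp only [hT]
    rw [(smB n).tsum_eq_zero_add, B.map_tsum (smB (n + δ))]
    refine congrArg₂ (· + ·) (by simp) ?_
    · congr 1
      funext k
      rw [pow_succ', show n + δ * (k + 1) = n + δ + δ * k by ring]; rfl
  have hzero : ∀ n, n < δ → T n = 0 := by
    intro n hn
    have hr := aux_residue A d V Vc hV h ⟨n, hn⟩
    have hAn : Function.Injective (A ^ n) := by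
      rw [ContinuousLinearMap.coe_pow']
      exact hA.iterate n
    apply hAn
    rw [map_zero, ← hr, hT, (A ^ n).map_tsum (smB n)]
    congr 1
    funext k
    rw [pow_add, pow_mul, ← hB]; rfl
  set a : ℕ → E := fun n => T (n + δ) with ha
  obtain ⟨hd, hs⟩ := aux_entire a (by
    intro R hR
    set S := max R (max 1 ‖A‖) with hSdef
    have hRS : R ≤ S := le_max_left _ _
    have h1S : 1 ≤ S := (le_max_left _ _).trans (le_max_right _ _)
    have hAS : ‖A‖ ≤ S := (le_max_right _ _).trans (le_max_right _ _)
    refine ⟨∑' m, S ^ m * ‖Vc m‖, fun n => ?_⟩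
    refine le_trans ?_ (hTb S h1S hAS (n + δ))
    have : R ^ n ≤ S ^ (n + δ) :=
      (pow_le_pow_left₀ hR.le hRS n).trans (pow_le_pow_right₀ h1S (by omega))
    gcongr)
  refine ⟨_, hd, fun ξ => ?_⟩
  have hs1 : HasSum (fun n => ξ ^ n • T n) (ξ ^ δ • ∑' n, ξ ^ n • a n) := by
    refine aux_shift _ (fun n => ξ ^ δ • ξ ^ n • a n) δ _ (fun n hn => by simp [hzero n hn])
      (fun n => ?_) ((hs ξ).hasSum.const_smul _)
    rw [pow_add, mul_comm, mul_smul]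
  have hs2 := B.hasSum (hs ξ).hasSum
  refine (hV ξ).unique ?_
  convert hs1.sub hs2 using 1
  funext n
  simp only [Function.comp, map_smul]
  rw [← smul_sub, hrec n]
  simp [ha]


/-- Let `E` be a finite-dimensional complex vector space, `A` an invertible
(continuous) linear endomorphism of `E`, and `δ ≥ 1`. For an entire `V : ℂ → E` with
Taylor coefficients `Vc` (i.e. `V(ξ) = Σ ξ^n • Vc n`), and any endomorphism `M`, the
series `V(M) = Σ M^n (Vc n)` converges absolutely. Moreover:
(a) `W ↦ (ξ ↦ ξ^δ • W ξ - A^δ (W ξ))` is injective on `E`-valued entire functions;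
(b) an entire `V` is of the form `ξ^δ W(ξ) - A^δ W(ξ)` for an entire `W` iff
`V(jA) = 0` for every `δ`-th root of unity `j`. -/
theorem entire_qdiff_operator_image (E : Type*) [NormedAddCommGroup E]
    [NormedSpace ℂ E] [FiniteDimensional ℂ E]
    (A : E →L[ℂ] E) (hA : Function.Bijective A) (δ : ℕ) (hδ : 1 ≤ δ) :
    (∀ (M : E →L[ℂ] E) (V : ℂ → E) (Vc : ℕ → E), Differentiable ℂ V →
        (∀ ξ : ℂ, HasSum (fun n : ℕ => ξ ^ n • Vc n) (V ξ)) →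
        Summable (fun n : ℕ => ‖(M ^ n) (Vc n)‖)) ∧
    (∀ W₁ W₂ : ℂ → E, Differentiable ℂ W₁ → Differentiable ℂ W₂ →
        (∀ ξ : ℂ, ξ ^ δ • W₁ ξ - (A ^ δ) (W₁ ξ) = ξ ^ δ • W₂ ξ - (A ^ δ) (W₂ ξ)) →
        W₁ = W₂) ∧
    (∀ (V : ℂ → E) (Vc : ℕ → E), Differentiable ℂ V →
        (∀ ξ : ℂ, HasSum (fun n : ℕ => ξ ^ n • Vc n) (V ξ)) →
        ((∃ W : ℂ → E, Differentiable ℂ W ∧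
            ∀ ξ : ℂ, V ξ = ξ ^ δ • W ξ - (A ^ δ) (W ξ)) ↔
          ∀ j : ℂ, j ^ δ = 1 → (∑' n : ℕ, ((j • A) ^ n) (Vc n)) = 0)) := by
  haveI : CompleteSpace E := FiniteDimensional.complete ℂ E
  refine ⟨fun M V Vc _ hV => aux_end_summable M V Vc hV,
    fun W₁ W₂ h₁ h₂ h => aux_inj (A ^ δ) δ hδ W₁ W₂ h₁ h₂ h, fun V Vc _ hV => ⟨?_, ?_⟩⟩
  · rintro ⟨W, hW, h⟩ j hj
    exact aux_fwd A δ V Vc hV W hW h j hj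
  · intro h
    obtain ⟨d, rfl⟩ : ∃ d, δ = d + 1 := ⟨δ - 1, by omega⟩
    exact aux_bwd A hA.1 d V Vc hV h
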